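/- Colorability criterion via m-th powers: Let G be a finite simple graph with vertex set V, edge set E, and a fixed reference orientation assigning to each edge e the ordered pair (h(e), t(e)) of its endpoints. Let k ≥ 1 and m ≥ 1, suppose q = m·k + 1 is a prime power, and let F be a finite field with q elements. Then G admits a proper vertex coloring in at most k colors if and only if there exists an assignment a : V → F such that (∏_{v ∈ V} a(v)) · ∏_{e ∈ E} (a(h(e))^m − a(t(e))^m) ≠ 0 in F. -/

import Mathlib

open Finset

variable {V : Type*} [Fintype V] [DecidableEq V]

/-- An orientation of a simple graph `G`: for each edge, a choice of the
source endpoint (the vertex the edge is directed away from). -/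
abbrev SimpleGraph.Orient (G : SimpleGraph V) [DecidableRel G.Adj] : Type _ :=
  {D : G.edgeFinset → V // ∀ e : G.edgeFinset, D e ∈ (e : Sym2 V)}

namespace SimpleGraph.Orient

variable {G : SimpleGraph V} [DecidableRel G.Adj]

/-- `s⁺_D(v)`: the outdegree of `v` under the orientation `D`, i.e. the number of
edges directed away from `v`. -/
abbrev outdeg (D : G.Orient) (v : V) : ℕ :=
  (Finset.univ.filter fun e : G.edgeFinset => D.1 e = v).card

/-- The head of the edge `e` under the orientation `D`: the endpoint of `e` other
than the source `D.1 e` (so `e` is directed as `(D.1 e, head D e)`). -/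
abbrev head (D : G.Orient) (e : G.edgeFinset) : V :=
  Sym2.Mem.other' (D.2 e)

/-- The number of edges on which two orientations differ. -/
abbrev flips (D D' : G.Orient) : ℕ :=
  (Finset.univ.filter fun e : G.edgeFinset => D.1 e ≠ D'.1 e).card

/-- Two orientations are congruent modulo `k` if the outdegrees of every vertex
are congruent modulo `k`. -/
abbrev CongMod (k : ℕ) (D D' : G.Orient) : Prop :=
  ∀ v : V, (outdeg D v : ZMod k) = (outdeg D' v : ZMod k)

/-- Two orientations agree if one is obtained from the other by reversing the
direction of an even number of edges. -/
abbrev Agree (D D' : G.Orient) : Prop := Even (flips D D')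

end SimpleGraph.Orient

open SimpleGraph.Orient

/-- A product of differences over the oriented edges is nonzero iff the function separates
adjacent vertices. -/
theorem SimpleGraph.Orient.prod_sub_ne_zero_iff {G : SimpleGraph V} [DecidableRel G.Adj]
    (D : G.Orient) {R : Type*} [CommRing R] [IsDomain R] (f : V → R) :
    ∏ e : G.edgeFinset, (f (D.1 e) - f (head D e)) ≠ 0 ↔ ∀ u v, G.Adj u v → f u ≠ f v := by
  have hspec (e : G.edgeFinset) : s(D.1 e, head D e) = (e : Sym2 V) :=
    Sym2.other_spec' (D.2 e)
  simp only [Finset.prod_ne_zero_iff, Finset.mem_univ, true_implies, sub_ne_zero]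
  constructor
  · intro h u v huv
    have he := h ⟨s(u, v), SimpleGraph.mem_edgeFinset.2 huv⟩
    rcases Sym2.eq_iff.1 (hspec ⟨s(u, v), SimpleGraph.mem_edgeFinset.2 huv⟩) with
      ⟨hu, hv⟩ | ⟨hv, hu⟩
    · rwa [hu, hv] at he
    · rw [hu, hv] at he
      exact he.symm
  · intro h e
    apply h
    rw [← SimpleGraph.mem_edgeSet, hspec e]
    exact SimpleGraph.mem_edgeFinset.1 e.2

/-- A finite field with `m * k + 1` elements has exactly `k` nonzero `m`-th powers. -/
theorem FiniteField.card_range_powMonoidHom_units {F : Type*} [Field F] [Fintype F] {k m : ℕ}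
    (hm : 1 ≤ m) (hF : Fintype.card F = m * k + 1) :
    Nat.card (powMonoidHom m : Fˣ →* Fˣ).range = k := by
  have hcard : Nat.card Fˣ = m * k := by
    rw [Nat.card_units, Nat.card_eq_fintype_card, hF, Nat.add_sub_cancel]
  rw [IsCyclic.card_powMonoidHom_range, hcard, Nat.gcd_mul_right_left,
    Nat.mul_div_cancel_left _ hm]

/-- Colorability criterion via `m`-th powers: for a finite field `F` with
`m·k + 1` elements, `G` is colorable in at most `k` colors iff there is
`a : V → F` with `(∏_v a v) · ∏_{e ∈ E} (a(h(e))^m − a(t(e))^m) ≠ 0`. -/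
theorem colorable_iff_exists_nonzero_power_assignment
    (G : SimpleGraph V) [DecidableRel G.Adj] (Dref : G.Orient)
    (k m : ℕ) (hk : 1 ≤ k) (hm : 1 ≤ m) (F : Type*) [Field F] [Fintype F]
    (hF : Fintype.card F = m * k + 1) :
    G.Colorable k ↔
      ∃ a : V → F,
        (∏ v : V, a v) *
          ∏ e : G.edgeFinset, (a (Dref.1 e) ^ m - a (head Dref e) ^ m) ≠ 0 := by
  let colors : (powMonoidHom m : Fˣ →* Fˣ).range ≃ Fin k :=
    Finite.equivFinOfCardEq (FiniteField.card_range_powMonoidHom_units hm hF)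
  simp only [mul_ne_zero_iff, Dref.prod_sub_ne_zero_iff (fun v => _ ^ m),
    Finset.prod_ne_zero_iff, Finset.mem_univ, true_implies]
  constructor
  · rintro ⟨c⟩
    choose b hb using fun v => (colors.symm (c v)).2
    refine ⟨fun v => b v, fun v => (b v).ne_zero, fun u v huv heq => c.valid huv ?_⟩
    apply colors.symm.injective
    apply Subtype.ext
    rw [← hb u, ← hb v]
    exact Units.ext (by simpa using heq)
  · rintro ⟨a, ha, hsep⟩
    refine ⟨SimpleGraph.Coloring.mk
      (fun v => colors ⟨Units.mk0 (a v) (ha v) ^ m, Units.mk0 (a v) (ha v), rfl⟩) ?_⟩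
    intro u v huv heq
    apply hsep u v huv
    simpa using congrArg Units.val (congrArg Subtype.val (colors.injective heq))
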